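/- For all oriented paths P and Q, the 2-colour asymmetric directed Ramsey number satisfies R(P, Q) ≤ 2·16²·(|P| + |Q|). -/

import Mathlib

/-- The oriented path of length `n` (on `n+1` vertices) whose `i`-th edge is directed
forwards iff `ε i = true`. -/
def PathRel (n : ℕ) (ε : ℕ → Bool) (x y : Fin (n + 1)) : Prop :=
  ∃ i : ℕ, i < n ∧
    ((ε i = true ∧ (x : ℕ) = i ∧ (y : ℕ) = i + 1) ∨
     (ε i = false ∧ (x : ℕ) = i + 1 ∧ (y : ℕ) = i))

/-- The length of the longest directed subpath of the oriented path of length `n`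
encoded by `ε`, i.e. the longest constant run of `ε` inside `[0, n)`. -/
noncomputable def maxRun (n : ℕ) (ε : ℕ → Bool) : ℕ :=
  sSup {d | ∃ a, a + d ≤ n ∧ ∀ i, a ≤ i → i < a + d → ε i = ε a}


/-- A directed path on list `l` inside `T`. -/
def DPath {V : Type*} (D : V → V → Prop) (T : Finset V) (l : List V) : Prop :=
  l.Nodup ∧ l.IsChain D ∧ ∀ x ∈ l, x ∈ T

/-- Splicing: from a maximum path `R` and a disjoint path `Q`. -/
lemma splice_len {V : Type*} {D : V → V → Prop} {T : Finset V} {R Q : List V}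
    (hR : DPath D T R) (hQ : DPath D T Q) (hdis : ∀ x ∈ R, x ∉ Q)
    (hmax : ∀ l, DPath D T l → l.length ≤ R.length)
    (K i j m : ℕ) (hij : i ≤ j) (hj : j < Q.length) (hKm : K ≤ m) (hm : m ≤ R.length)
    (h1 : ∀ (h : 0 < K), D (R[K-1]'(by omega)) (Q[i]'(by omega)))
    (h2 : ∀ (h : m < R.length), D (Q[j]) (R[m])) :
    K + (j - i) + 1 ≤ m := by
  have key := hmax (R.take K ++ ((Q.drop i).take (j - i + 1) ++ R.drop m)) ?_
  · simp at key
    omega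
  · obtain ⟨n1, c1, s1⟩ := hR
    obtain ⟨n2, c2, s2⟩ := hQ
    refine ⟨?_, ?_, ?_⟩
    · have e : ∀ x ∈ (Q.drop i).take (j - i + 1), x ∈ Q := fun x hx =>
        List.mem_of_mem_drop (List.mem_of_mem_take hx)
      refine List.nodup_append.2 ⟨n1.sublist (List.take_sublist _ _), List.nodup_append.2
        ⟨n2.sublist ((List.take_sublist _ _).trans (List.drop_sublist _ _)),
          n1.sublist (List.drop_sublist _ _), ?_⟩, ?_⟩
      · rintro a ha b hb rfl
        exact hdis a (List.mem_of_mem_drop hb) (e a ha)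
      · rintro a ha b hb rfl
        rcases List.mem_append.1 hb with hb | hb
        · exact hdis a (List.mem_of_mem_take ha) (e a hb)
        · have : (R.take m ++ R.drop m).Nodup := by simpa using n1
          have h3 := (List.nodup_append.1 this).2.2
          exact h3 a ((List.take_sublist_take_left hKm).subset ha) a hb rfl
    · rw [List.isChain_append, List.isChain_append]
      refine ⟨c1.take _, ⟨(c2.drop _).take _, c1.drop _, ?_⟩, ?_⟩
      · intro x hx y hy
        have hmR : m < R.length := by
          by_contra hcon
          have : R.drop m = [] := List.drop_eq_nil_of_le (by omega)
          simp [this] at hy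
        have := h2 hmR
        rw [List.getLast?_eq_getElem?] at hx
        simp at hx hy
        have hmin : min (j - i + 1) (Q.length - i) = j - i + 1 := by omega
        rw [hmin] at hx
        simp at hx
        rw [List.getElem?_eq_getElem hmR] at hy
        have : i + (j - i) = j := by omega
        rw [this, List.getElem?_eq_getElem hj] at hx
        simp at hx hy
        subst hx; subst hy; assumption
      · intro x hx y hy
        have hK : 0 < K := by
          by_contra hcon
          have : K = 0 := by omega
          subst this
          simp at hx
        have := h1 hK
        rw [List.getLast?_eq_getElem?] at hx
        have hlen : (R.take K).length = K := by simp; omega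
        rw [hlen, List.getElem?_take] at hx
        have hi : i < Q.length := by omega
        have hK2 : K - 1 < R.length := by omega
        simp [hi, hK, List.head?_take, List.head?_append] at hx hy
        rw [List.getElem?_eq_getElem hK2] at hx
        simp at hx
        subst hx; subst hy; assumption
    · intro x hx
      simp only [List.mem_append] at hx
      rcases hx with hx | hx | hx
      · exact s1 _ (List.mem_of_mem_take hx)
      · exact s2 _ (List.mem_of_mem_drop (List.mem_of_mem_take hx))
      · exact s1 _ (List.mem_of_mem_drop hx)


lemma exists_last {V : Type*} (D : V → V → Prop) (R : List V) (c : V) :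
    ∃ K ≤ R.length, (∀ hK : K - 1 < R.length, 0 < K → D (R[K-1]) c) ∧
      ∀ m, K ≤ m → ∀ hm : m < R.length, ¬ D (R[m]) c := by
  classical
  have hex : ∃ K, ∀ m, K ≤ m → ∀ hm : m < R.length, ¬ D (R[m]) c :=
    ⟨R.length, fun m h1 h2 => by omega⟩
  refine ⟨Nat.find hex, Nat.find_min' hex (fun m h1 h2 => by omega), ?_, Nat.find_spec hex⟩
  intro hK hpos
  have := Nat.find_min hex (m := Nat.find hex - 1) (by omega)
  push Not at this
  obtain ⟨m, h1, h2, h3⟩ := this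
  have hm : m = Nat.find hex - 1 := by
    by_contra hne
    exact Nat.find_spec hex m (by omega) h2 h3
  subst hm
  exact h3

/-- The positions used in the weaving argument. -/
def zseq (K : ℕ → ℕ) : ℕ → ℕ
  | 0 => K 0
  | j + 1 => max (zseq K j + 1) (K (j + 1))

lemma zseq_ge (K : ℕ → ℕ) (j : ℕ) : ∀ i ≤ j, K i ≤ zseq K j := by
  induction j with
  | zero => intro i hi; obtain rfl : i = 0 := by omega
            exact le_rfl
  | succ j ih =>
    intro i hi
    simp only [zseq]
    rcases Nat.lt_or_ge i (j+1) with h | h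
    · have := ih i (by omega); omega
    · obtain rfl : i = j + 1 := by omega
      omega

lemma zseq_eq (K : ℕ → ℕ) (j : ℕ) : ∃ i ≤ j, zseq K j = K i + (j - i) := by
  induction j with
  | zero => exact ⟨0, le_rfl, by simp [zseq]⟩
  | succ j ih =>
    obtain ⟨i, hi, h⟩ := ih
    simp only [zseq]
    rcases le_total (K (j+1)) (zseq K j + 1) with h1 | h1
    · exact ⟨i, by omega, by omega⟩
    · exact ⟨j+1, le_rfl, by omega⟩

lemma zseq_strict (K : ℕ → ℕ) : StrictMono (zseq K) :=
  strictMono_nat_of_lt_succ (fun j => by simp only [zseq]; omega)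

lemma weave {V : Type*} {D E : V → V → Prop} (hDE : ∀ x y, x ≠ y → D x y ∨ E x y)
    {T : Finset V} {R Q : List V}
    (hR : DPath D T R) (hQ : DPath D T Q) (hdis : ∀ x ∈ R, x ∉ Q)
    (hmax : ∀ l, DPath D T l → l.length ≤ R.length) :
    ∃ l, DPath E T l ∧ l.length = 2 * Q.length := by
  classical
  have hKex : ∀ i, ∃ K, K ≤ R.length ∧ ∀ hi : i < Q.length,
      (∀ hK : K - 1 < R.length, 0 < K → D (R[K-1]) Q[i]) ∧
      ∀ m, K ≤ m → ∀ hm : m < R.length, ¬ D (R[m]) Q[i] := by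
    intro i
    by_cases hi : i < Q.length
    · obtain ⟨K, a, b, c⟩ := exists_last D R Q[i]
      exact ⟨K, a, fun _ => ⟨b, c⟩⟩
    · exact ⟨0, by omega, fun h => absurd h hi⟩
  choose K hKle hK using hKex
  have hzr : ∀ j, j < Q.length → zseq K j < R.length := by
    intro j hj
    obtain ⟨i, hi, he⟩ := zseq_eq K j
    have := splice_len hR hQ hdis hmax (K i) i (Q.length - 1) R.length (by omega) (by omega)
      (hKle i) le_rfl (fun h => (hK i (by omega)).1 (by have := hKle i; omega) h)
      (fun h => by omega)
    omega
  have hE1 : ∀ j (hj : j < Q.length), E Q[j] (R[zseq K j]'(hzr j hj)) := by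
    intro j hj
    rcases hDE Q[j] (R[zseq K j]'(hzr j hj)) (by
      intro h
      exact hdis _ (List.getElem_mem (hzr j hj)) (h ▸ List.getElem_mem hj)) with h | h
    · exfalso
      obtain ⟨i, hi, he⟩ := zseq_eq K j
      have hz := hzr j hj
      have := splice_len hR hQ hdis hmax (K i) i j (zseq K j) hi hj
        (by omega) (by omega) (fun h => (hK i (by omega)).1 (by have := hKle i; omega) h)
        (fun _ => h)
      omega
    · exact h
  have hE2 : ∀ i j (hj : j < Q.length) (hij : i ≤ j),
      E (R[zseq K j]'(hzr j hj)) (Q[i]'(by omega)) := by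
    intro i j hj hij
    rcases hDE (R[zseq K j]'(hzr j hj)) (Q[i]'(by omega)) (by
      intro h
      exact hdis _ (List.getElem_mem (hzr j hj)) (h ▸ List.getElem_mem _)) with h | h
    · exact absurd h ((hK i (by omega)).2 _ (zseq_ge K j i hij) (hzr j hj))
    · exact h
  have main : ∀ n, n ≤ Q.length → ∃ l : List V, l.length = 2 * n ∧ l.Nodup ∧ l.IsChain E ∧
      (∀ y ∈ l.head?, ∃ i, ∃ h : i < Q.length, i + 1 = n ∧ Q[i] = y) ∧
      (∀ x ∈ l, ∃ i, ∃ h : i < Q.length, i < n ∧ (Q[i] = x ∨ R[zseq K i]'(hzr i h) = x)) := by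
    intro n
    induction n with
    | zero => intro _; exact ⟨[], by simp⟩
    | succ n ih =>
      intro hn
      obtain ⟨l, h1, h2, h3, h4, h5⟩ := ih (by omega)
      have hnQ : n < Q.length := by omega
      have hz := hzr n hnQ
      refine ⟨Q[n] :: R[zseq K n] :: l, by simp; omega, ?_, ?_, ?_, ?_⟩
      · rw [List.nodup_cons, List.nodup_cons]
        refine ⟨?_, ?_, h2⟩
        · intro hmem
          rcases List.mem_cons.1 hmem with h | h
          · exact hdis _ (List.getElem_mem hz) (h ▸ List.getElem_mem hnQ)
          · obtain ⟨i, hi, hin, h | h⟩ := h5 _ h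
            · have := (hQ.1.getElem_inj_iff).1 h
              omega
            · exact hdis _ (List.getElem_mem (hzr i hi)) (h ▸ List.getElem_mem hnQ)
        · intro hmem
          obtain ⟨i, hi, hin, h | h⟩ := h5 _ hmem
          · exact hdis _ (List.getElem_mem hz) (h ▸ List.getElem_mem hi)
          · have := (hR.1.getElem_inj_iff).1 h
            have := zseq_strict K hin
            omega
      · rw [List.isChain_cons_cons, List.isChain_cons]
        refine ⟨hE1 n hnQ, ?_, h3⟩
        intro y hy
        obtain ⟨i, hi, hin, rfl⟩ := h4 y hy
        exact hE2 i n hnQ (by omega)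
      · intro y hy
        simp at hy
        exact ⟨n, hnQ, rfl, hy⟩
      · intro x hx
        rcases List.mem_cons.1 hx with h | h
        · exact ⟨n, hnQ, by omega, Or.inl h.symm⟩
        rcases List.mem_cons.1 h with h | h
        · exact ⟨n, hnQ, by omega, Or.inr h.symm⟩
        obtain ⟨i, hi, hin, h⟩ := h5 x h
        exact ⟨i, hi, by omega, h⟩
  obtain ⟨l, h1, h2, h3, h4, h5⟩ := main Q.length le_rfl
  refine ⟨l, ⟨h2, h3, ?_⟩, h1⟩
  intro x hx
  obtain ⟨i, hi, hin, rfl | rfl⟩ := h5 x hx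
  · exact hQ.2.2 _ (List.getElem_mem _)
  · exact hR.2.2 _ (List.getElem_mem _)

lemma DPath.length_le {V : Type*} {D : V → V → Prop} {T : Finset V} {l : List V}
    (h : DPath D T l) : l.length ≤ T.card := by
  classical
  rw [← List.toFinset_card_of_nodup h.1]
  exact Finset.card_le_card (fun x hx => h.2.2 x (by simpa using hx))

lemma exists_longest {V : Type*} (D : V → V → Prop) (T : Finset V) :
    ∃ R, DPath D T R ∧ ∀ l, DPath D T l → l.length ≤ R.length := by
  classical
  let P : ℕ → Prop := fun n => ∃ l, DPath D T l ∧ l.length = n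
  have h0 : P 0 := ⟨[], by simp [DPath], rfl⟩
  obtain ⟨R, hR, hlen⟩ := Nat.findGreatest_spec (P := P) (Nat.zero_le T.card) h0
  refine ⟨R, hR, fun l hl => ?_⟩
  rw [hlen]
  exact Nat.le_findGreatest hl.length_le ⟨l, hl, rfl⟩

lemma DPath.mono {V : Type*} {D : V → V → Prop} {S T : Finset V} {l : List V}
    (h : DPath D S l) (hST : S ⊆ T) : DPath D T l :=
  ⟨h.1, h.2.1, fun x hx => hST (h.2.2 x hx)⟩

lemma linear_paths {V : Type*} (n : ℕ) : ∀ (D E : V → V → Prop)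
    (_ : ∀ x y, x ≠ y → D x y ∨ E x y) (T : Finset V) (_ : T.card = n),
    ∃ l1 l2, DPath D T l1 ∧ DPath E T l2 ∧ T.card ≤ 2 * (l1.length + l2.length) := by
  classical
  induction n using Nat.strong_induction_on with
  | _ n ih =>
  have aux : ∀ (D E : V → V → Prop)
    (_ : ∀ x y, x ≠ y → D x y ∨ E x y) (T : Finset V) (_ : T.card = n) (l1 l2 : List V)
    (_ : DPath D T l1) (_ : DPath E T l2)
    (_ : ∀ l, DPath D T l → l.length ≤ l1.length) 
    (_ : ∀ l, DPath E T l → l.length ≤ l2.length) (_ : l2.length ≤ l1.length),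
    T.card ≤ 2 * (l1.length + l2.length) := by
    intro D E hDE T hT l1 l2 h1 h2 m1 m2 hle
    rcases Nat.eq_zero_or_pos n with h0 | h0
    · omega
    obtain ⟨x, hx⟩ := Finset.card_pos.1 (hT ▸ h0)
    have hpos := m1 [x] ⟨by simp, by simp, by simpa using hx⟩
    simp at hpos
    have hsub : l1.toFinset ⊆ T := fun x hx => h1.2.2 x (by simpa using hx)
    have hc := Finset.card_sdiff_add_card_eq_card hsub
    rw [List.toFinset_card_of_nodup h1.1] at hc
    obtain ⟨a, b, ha, hb, hab⟩ := ih (T \ l1.toFinset).card (by omega) D E hDE _ rfl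
    have hb' := m2 b (hb.mono Finset.sdiff_subset)
    obtain ⟨w, hw, hwl⟩ := weave hDE h1 (ha.mono Finset.sdiff_subset) (by
      intro x hx hxa
      have := ha.2.2 x hxa
      simp [hx] at this) m1
    have := m2 w hw
    omega
  intro D E hDE T hT
  obtain ⟨l1, h1, m1⟩ := exists_longest D T
  obtain ⟨l2, h2, m2⟩ := exists_longest E T
  refine ⟨l1, l2, h1, h2, ?_⟩
  rcases le_total l2.length l1.length with h | h
  · exact aux D E hDE T hT l1 l2 h1 h2 m1 m2 h
  · have := aux E D (fun x y h => (hDE x y h).symm) T hT l2 l1 h2 h1 m2 m1 h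
    omega

lemma two_paths {V : Type*} {D E : V → V → Prop} (hDE : ∀ x y, x ≠ y → D x y ∨ E x y)
    {T : Finset V} {p q : ℕ} (hT : 2 * (p + q) + 1 ≤ T.card) :
    (∃ l, DPath D T l ∧ l.length = p + 1) ∨ (∃ l, DPath E T l ∧ l.length = q + 1) := by
  obtain ⟨l1, l2, h1, h2, h⟩ := linear_paths T.card D E hDE T rfl
  have tk : ∀ (F : V → V → Prop) (l : List V) (n : ℕ), DPath F T l → n ≤ l.length →
      ∃ l, DPath F T l ∧ l.length = n := by
    intro F l n hl hn
    exact ⟨l.take n, ⟨hl.1.sublist (List.take_sublist _ _), hl.2.1.take _,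
      fun x hx => hl.2.2 x (List.mem_of_mem_take hx)⟩, by simp; omega⟩
  rcases Nat.lt_or_ge p l1.length with h' | h'
  · exact Or.inl (tk D l1 _ h1 h')
  · exact Or.inr (tk E l2 _ h2 (by omega))

/-- The edge `v — w` in direction `b`. -/
def Edge {V : Type*} (D : V → V → Prop) (b : Bool) (v w : V) : Prop :=
  if b then D v w else D w v

/-- Reversed list which embeds the pattern `ε`. -/
def PE {V : Type*} (D : V → V → Prop) (ε : ℕ → Bool) : List V → Prop
  | [] => True
  | [_] => True
  | w :: v :: l => Edge D (ε l.length) v w ∧ PE D ε (v :: l)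

lemma PE.tail {V : Type*} {D : V → V → Prop} {ε : ℕ → Bool} {a : V} {l : List V}
    (h : PE D ε (a :: l)) : PE D ε l := by
  cases l with
  | nil => trivial
  | cons b l => exact h.2

/-- An oriented path with pattern `ε`, as a function on naturals. -/
def HasPath {V : Type*} (D : V → V → Prop) (ε : ℕ → Bool) (p : ℕ) : Prop :=
  ∃ f : ℕ → V, (∀ i j, i ≤ p → j ≤ p → f i = f j → i = j) ∧
    ∀ i < p, Edge D (ε i) (f i) (f (i + 1))

lemma PE.edge {V : Type*} {D : V → V → Prop} {ε : ℕ → Bool} (l : List V)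
    (h : PE D ε l) : ∀ i (hi : i + 1 < l.length),
      Edge D (ε i) (l[l.length - 1 - i]'(by omega)) (l[l.length - 1 - (i+1)]'(by omega)) := by
  induction l with
  | nil => intro i hi; simp at hi
  | cons w l ih =>
    cases l with
    | nil => intro i hi; simp at hi
    | cons v l =>
      intro i hi
      rcases Nat.lt_or_ge (i + 1) (v :: l).length with h' | h'
      · have := ih h.2 i h'
        simp at h'
        obtain ⟨k, hk⟩ : ∃ k, l.length = i + 1 + k := ⟨l.length - i - 1, by omega⟩
        simp only [List.length_cons, hk] at this ⊢
        have e1 : i + 1 + k + 1 + 1 - 1 - i = (k + 1) + 1 := by omega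
        have e2 : i + 1 + k + 1 + 1 - 1 - (i + 1) = k + 1 := by omega
        have e3 : i + 1 + k + 1 - 1 - i = k + 1 := by omega
        have e4 : i + 1 + k + 1 - 1 - (i + 1) = k := by omega
        simp only [e1, e2, e3, e4, List.getElem_cons_succ] at this ⊢
        exact this
      · simp at h' hi
        obtain rfl : i = l.length := by omega
        have := h.1
        simp only [List.length_cons]
        have e1 : l.length + 1 + 1 - 1 - l.length = 1 := by omega
        have e2 : l.length + 1 + 1 - 1 - (l.length + 1) = 0 := by omega
        simp only [e1, e2]
        exact this

lemma PE.hasPath {V : Type*} {D : V → V → Prop} {ε : ℕ → Bool} {p : ℕ} (l : List V)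
    (h : PE D ε l) (hn : l.Nodup) (hl : l.length = p + 1) : HasPath D ε p := by
  refine ⟨fun i => l[l.length - 1 - i]'(by omega), ?_, ?_⟩
  · intro i j hi hj hij
    have := (hn.getElem_inj_iff).1 hij
    omega
  · intro i hi
    exact PE.edge l h i (by omega)

lemma dfs {V : Type*} [DecidableEq V] (D : V → V → Prop) (ε : ℕ → Bool) (p m : ℕ) (T : Finset V)
    (hT : 3 * m + p + 1 ≤ T.card) (hno : ¬ HasPath D ε p) :
    ∀ (n : ℕ) (Sp Sm U : Finset V) (l : List V), 2 * U.card + l.length = n →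
      Sp ⊆ T → Sm ⊆ T → U ⊆ T → (∀ x ∈ l, x ∈ T) → l.Nodup → PE D ε l →
      Disjoint Sp U → Disjoint Sm U → (∀ x ∈ l, x ∉ U) →
      Sp.card + Sm.card + U.card + l.length = T.card →
      (∀ x ∈ Sp, ∀ y ∈ U, ¬ D x y) → (∀ x ∈ U, ∀ y ∈ Sm, ¬ D x y) →
      Sp.card ≤ m → Sm.card ≤ m → (∀ x ∈ l, x ∉ Sp ∧ x ∉ Sm) →
      ∃ A B : Finset V, A ⊆ T ∧ B ⊆ T ∧ Disjoint A B ∧ m ≤ A.card ∧ m ≤ B.card ∧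
        ∀ x ∈ A, ∀ y ∈ B, ¬ D x y := by
  intro n
  induction n using Nat.strong_induction_on with
  | _ n ih =>
  intro Sp Sm U l hn hSp hSm hU hl hnd hPE dp dm dl hc ep em cp cm hls
  have hlen : l.length ≤ p := by
    by_contra hcon
    have hp : PE D ε (l.drop (l.length - (p+1))) := by
      generalize l.length - (p+1) = k
      clear * - hPE
      induction k generalizing l with
      | zero => simpa using hPE
      | succ k ih =>
        cases l with
        | nil => simpa using hPE
        | cons a l => simpa using ih l hPE.tail
    exact hno (hp.hasPath _ (hnd.sublist (List.drop_sublist _ _)) (by simp; omega))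
  have hUm : m + 1 ≤ U.card := by omega
  rcases Nat.eq_or_lt_of_le cp with h | hp
  · exact ⟨Sp, U, hSp, hU, dp, by omega, by omega, ep⟩
  rcases Nat.eq_or_lt_of_le cm with h | hm
  · exact ⟨U, Sm, hU, hSm, dm.symm, by omega, by omega, em⟩
  -- adding a vertex to the path
  have addv : ∀ u ∈ U, PE D ε (u :: l) → ∃ A B : Finset V, A ⊆ T ∧ B ⊆ T ∧ Disjoint A B ∧
      m ≤ A.card ∧ m ≤ B.card ∧ ∀ x ∈ A, ∀ y ∈ B, ¬ D x y := by
    intro u hu hpe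
    have hcu := Finset.card_erase_add_one hu
    refine ih (2 * (U.erase u).card + (u :: l).length) (by simp only [List.length_cons]; omega)
      Sp Sm (U.erase u) (u :: l) rfl hSp hSm ((Finset.erase_subset _ _).trans hU) ?_ ?_ hpe
      (dp.mono_right (Finset.erase_subset _ _)) (dm.mono_right (Finset.erase_subset _ _)) ?_ ?_
      (fun x hx y hy => ep x hx y (Finset.mem_of_mem_erase hy))
      (fun x hx y hy => em x (Finset.mem_of_mem_erase hx) y hy) cp cm ?_
    · intro x hx
      rcases List.mem_cons.1 hx with rfl | h
      · exact hU hu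
      · exact hl x h
    · exact List.nodup_cons.2 ⟨fun h => dl u h hu, hnd⟩
    · intro x hx
      rcases List.mem_cons.1 hx with rfl | h
      · simp
      · exact fun h' => dl x h (Finset.mem_of_mem_erase h')
    · simp only [List.length_cons]; omega
    · intro x hx
      rcases List.mem_cons.1 hx with rfl | h
      · exact ⟨fun h => Finset.disjoint_left.1 dp h hu, fun h => Finset.disjoint_left.1 dm h hu⟩
      · exact hls x h
  cases l with
  | nil =>
    obtain ⟨u, hu⟩ := Finset.card_pos.1 (show 0 < U.card by omega)
    exact addv u hu trivial
  | cons v l =>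
    by_cases hex : ∃ u ∈ U, Edge D (ε l.length) v u
    · obtain ⟨u, hu, he⟩ := hex
      exact addv u hu ⟨he, hPE⟩
    · push Not at hex
      have hv := hls v (by simp)
      have hvU := dl v (by simp)
      have hvT := hl v (by simp)
      simp only [List.length_cons] at hn hc
      have hvl := (List.nodup_cons.1 hnd)
      by_cases hb : ε l.length = true
      · have hcard := Finset.card_insert_of_notMem hv.1
        refine ih (2 * U.card + l.length) (by omega) (insert v Sp) Sm U l rfl
          (Finset.insert_subset hvT hSp) hSm hU (fun x hx => hl x (by simp [hx])) hvl.2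
          hPE.tail (Finset.disjoint_insert_left.2 ⟨hvU, dp⟩) dm (fun x hx => dl x (by simp [hx]))
          (by omega) ?_ em (by omega) cm ?_
        · intro x hx y hy
          rcases Finset.mem_insert.1 hx with rfl | h
          · have := hex y hy
            simpa [Edge, hb] using this
          · exact ep x h y hy
        · intro x hx
          have := hls x (by simp [hx])
          refine ⟨?_, this.2⟩
          intro h
          rcases Finset.mem_insert.1 h with rfl | h
          · exact hvl.1 hx
          · exact this.1 h
      · have hcard := Finset.card_insert_of_notMem hv.2
        refine ih (2 * U.card + l.length) (by omega) Sp (insert v Sm) U l rfl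
          hSp (Finset.insert_subset hvT hSm) hU (fun x hx => hl x (by simp [hx])) hvl.2
          hPE.tail dp (Finset.disjoint_insert_left.2 ⟨hvU, dm⟩) (fun x hx => dl x (by simp [hx]))
          (by omega) ep ?_ cp (by omega) ?_
        · intro x hx y hy
          rcases Finset.mem_insert.1 hy with rfl | h
          · have := hex x hx
            simpa [Edge, hb] using this
          · exact em x hx y h
        · intro x hx
          have := hls x (by simp [hx])
          refine ⟨this.1, ?_⟩
          intro h
          rcases Finset.mem_insert.1 h with rfl | h
          · exact hvl.1 hx
          · exact this.2 h

lemma dfs_main {V : Type*} [DecidableEq V] (D : V → V → Prop) (ε : ℕ → Bool) (p m : ℕ)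
    (T : Finset V) (hT : 3 * m + p + 1 ≤ T.card) (hno : ¬ HasPath D ε p) :
    ∃ A B : Finset V, A ⊆ T ∧ B ⊆ T ∧ Disjoint A B ∧ m ≤ A.card ∧ m ≤ B.card ∧
        ∀ x ∈ A, ∀ y ∈ B, ¬ D x y :=
  dfs D ε p m T hT hno _ ∅ ∅ T [] rfl (by simp) (by simp) subset_rfl (by simp) (by simp)
    trivial (by simp) (by simp) (by simp) (by simp) (by simp) (by simp) (by simp) (by simp)
    (by simp)

lemma combine {V : Type*} {D : V → V → Prop} {A B : Finset V} (hAB : Disjoint A B)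
    (hD : ∀ x ∈ A, ∀ y ∈ B, D x y) {p : ℕ} {la lb : List V} (ha : DPath D A la)
    (hla : la.length = p + 1) (hb : DPath D B lb) (hlb : lb.length = p + 1) (ε : ℕ → Bool) :
    HasPath D ε p := by
  classical
  let t : ℕ → ℕ := fun i => Nat.count (fun j => ε j = true) i
  have ht0 : t 0 = 0 := by simp [t]
  have htt : ∀ i, ε i = true → t (i+1) = t i + 1 := by
    intro i h; simp [t, Nat.count_succ, h]
  have htf : ∀ i, ε i = false → t (i+1) = t i := by
    intro i h; simp [t, Nat.count_succ, h]
  have hti : ∀ i, t i ≤ i := fun i => Nat.count_le _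
  have mono : ∀ i j, i ≤ j → t i ≤ t j ∧ t j + i ≤ t i + j := by
    intro i j hij
    induction j, hij using Nat.le_induction with
    | base => omega
    | succ j hj ih =>
      cases h : ε j with
      | true => have := htt j h; omega
      | false => have := htf j h; omega
  -- side of vertex `i`: `true` means in `B`
  let s : ℕ → Bool := fun i => if i = 0 then true else ε (i - 1)
  have hs0 : s 0 = true := by simp [s]
  have hss : ∀ i, s (i+1) = ε i := by intro i; simp [s]
  let b : ℕ → V := fun k => if h : k < lb.length then lb[k] else lb[0]
  let a : ℕ → V := fun k => if h : k < la.length then la[k] else la[0]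
  have hbB : ∀ k, b k ∈ B := by
    intro k; simp only [b]; split_ifs
    · exact hb.2.2 _ (List.getElem_mem _)
    · exact hb.2.2 _ (List.getElem_mem _)
  have haA : ∀ k, a k ∈ A := by
    intro k; simp only [a]; split_ifs
    · exact ha.2.2 _ (List.getElem_mem _)
    · exact ha.2.2 _ (List.getElem_mem _)
  have hbi : ∀ k k', k ≤ p → k' ≤ p → b k = b k' → k = k' := by
    intro k k' h h' he
    simp only [b, show k < lb.length by omega, show k' < lb.length by omega, dif_pos] at he
    exact (hb.1.getElem_inj_iff).1 he
  have hai : ∀ k k', k ≤ p → k' ≤ p → a k = a k' → k = k' := by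
    intro k k' h h' he
    simp only [a, show k < la.length by omega, show k' < la.length by omega, dif_pos] at he
    exact (ha.1.getElem_inj_iff).1 he
  have hbc : ∀ k, k < p → D (b k) (b (k+1)) := by
    intro k h
    simp only [b, show k < lb.length by omega, show k + 1 < lb.length by omega, dif_pos]
    exact List.isChain_iff_getElem.1 hb.2.1 k (by omega)
  have hac : ∀ k, k < p → D (a k) (a (k+1)) := by
    intro k h
    simp only [a, show k < la.length by omega, show k + 1 < la.length by omega, dif_pos]
    exact List.isChain_iff_getElem.1 ha.2.1 k (by omega)
  -- distinct vertices on the same side have different counters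
  have st : ∀ i j, i < j → s j = true → t i < t j := by
    intro i j hij hj
    obtain ⟨k, rfl⟩ : ∃ k, j = k + 1 := ⟨j - 1, by omega⟩
    rw [hss] at hj
    have := htt k hj
    have := (mono i k (by omega)).1
    omega
  have sf : ∀ i j, i < j → s j = false → i - t i < j - t j := by
    intro i j hij hj
    obtain ⟨k, rfl⟩ : ∃ k, j = k + 1 := ⟨j - 1, by omega⟩
    rw [hss] at hj
    have := htf k hj
    have := (mono i k (by omega)).2
    have := hti k
    have := hti i
    omega
  let f : ℕ → V := fun i => if s i = true then b (t i) else a (p - (i - t i))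
  have inj : ∀ i j, i < j → j ≤ p → f i ≠ f j := by
    intro i j hij hj he
    have := hti i
    have := hti j
    cases hi' : s i <;> cases hj' : s j <;> simp [f, hi', hj'] at he
    · have := hai _ _ (by omega) (by omega) he
      have := sf i j hij hj'
      omega
    · exact Finset.disjoint_left.1 hAB (haA (p - (i - t i))) (he ▸ hbB _)
    · exact Finset.disjoint_left.1 hAB (haA (p - (j - t j))) (he ▸ hbB _)
    · have := hbi _ _ (by omega) (by omega) he
      have := st i j hij hj'
      omega
  refine ⟨f, ?_, ?_⟩
  · intro i j hi hj he
    rcases lt_trichotomy i j with h | h | h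
    · exact absurd he (inj i j h hj)
    · exact h
    · exact absurd he.symm (inj j i h hi)
  · intro i hi
    have := hti i
    cases he : ε i with
    | true =>
      have h1 := htt i he
      cases hs : s i with
      | true =>
        simp only [Edge, f, hss, he, hs, h1, if_true]
        exact hbc _ (by omega)
      | false =>
        simp only [Edge, f, hss, he, hs, if_true]
        exact hD _ (haA _) _ (hbB _)
    | false =>
      have h1 := htf i he
      cases hs : s i with
      | true =>
        simp [Edge, f, hss, he, hs]
        exact hD _ (haA _) _ (hbB _)
      | false =>
        simp [Edge, f, hss, he, hs, h1]
        have := hac (p - (i + 1 - t i)) (by omega)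
        rwa [show p - (i + 1 - t i) + 1 = p - (i - t i) by omega] at this

lemma HasPath.embed {V : Type*} {D : V → V → Prop} {ε : ℕ → Bool} {p : ℕ}
    (h : HasPath D ε p) : ∃ f : Fin (p + 1) → V, Function.Injective f ∧
        ∀ x y, PathRel p ε x y → D (f x) (f y) := by
  obtain ⟨f, h1, h2⟩ := h
  refine ⟨fun i => f i, ?_, ?_⟩
  · intro i j hij
    exact Fin.ext (h1 i j (by omega) (by omega) hij)
  · rintro x y ⟨i, hi, ⟨he, hx, hy⟩ | ⟨he, hx, hy⟩⟩
    · have := h2 i hi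
      simp only [hx, hy]
      simpa [Edge, he] using this
    · have := h2 i hi
      simp only [hx, hy]
      simpa [Edge, he] using this

theorem directed_ramsey_two_paths (p q : ℕ) (εP εQ : ℕ → Bool) (N : ℕ)
    (hN : 2 * 16 ^ 2 * ((p + 1) + (q + 1)) ≤ N)
    (χ : Fin N → Fin N → Fin 2) :
    (∃ f : Fin (p + 1) → Fin N, Function.Injective f ∧
        ∀ x y, PathRel p εP x y → χ (f x) (f y) = 0) ∨
    (∃ f : Fin (q + 1) → Fin N, Function.Injective f ∧
        ∀ x y, PathRel q εQ x y → χ (f x) (f y) = 1) := by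
  classical
  let D : Fin N → Fin N → Prop := fun x y => χ x y = 0
  let E : Fin N → Fin N → Prop := fun x y => χ x y = 1
  have hDE : ∀ x y, D x y ∨ E x y := by
    intro x y
    simp only [D, E]
    omega
  by_cases hP : HasPath D εP p
  · exact Or.inl hP.embed
  by_cases hQ : HasPath E εQ q
  · exact Or.inr hQ.embed
  exfalso
  by_cases hall : ∀ T : Finset (Fin N), 3 * (2 * (p + q) + 1) + p + 1 ≤ T.card →
      ∃ l, DPath D T l ∧ l.length = p + 1
  · obtain ⟨A, B, _, _, dAB, hA, hB, hno⟩ :=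
      dfs_main E εQ q (3 * (2 * (p + q) + 1) + p + 1) Finset.univ (by simp; omega) hQ
    obtain ⟨la, ha, hla⟩ := hall A hA
    obtain ⟨lb, hb, hlb⟩ := hall B hB
    exact hP (combine dAB (fun x hx y hy => (hDE x y).resolve_right (hno x hx y hy))
      ha hla hb hlb εP)
  · push Not at hall
    obtain ⟨T, hT, hl⟩ := hall
    obtain ⟨A, B, hAT, hBT, dAB, hA, hB, hno⟩ := dfs_main D εP p (2 * (p + q) + 1) T hT hP
    obtain ⟨la, ha, hla⟩ := (two_paths (fun x y _ => hDE x y) hA).resolve_left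
      (fun ⟨l, h, h'⟩ => hl l (h.mono hAT) h')
    obtain ⟨lb, hb, hlb⟩ := (two_paths (fun x y _ => hDE x y) hB).resolve_left
      (fun ⟨l, h, h'⟩ => hl l (h.mono hBT) h')
    exact hQ (combine dAB (fun x hx y hy => (hDE x y).resolve_left (hno x hx y hy))
      ha hla hb hlb εQ)
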